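/- arXiv:math/0507422 — 4 statements merged into one kernel-verified Lean document; each statement's English description precedes it below -/
import Mathlib

section
/- Suppose {ψ_{j,l}} is orthonormal in L₂([0,1]^d, μ_d) and sup_{s∈[0,1]^d} Σ_{j∈I_l} |ψ_{j,l}(s)| ≤ c_ψ 2^{dl/2} for each l. Then for every α ∈ ℝⁿ and every level l ∈ {1, …, L}, Σ_{j∈I_l} |α_{j,l}| ≤ c_ψ 2^{dl/2} ‖f_α‖₁. (Key coefficient bound from the proof of Lemma 2.) -/
open MeasureTheory Finset
open scoped symmDiff

noncomputable section

/-- The unit cube `[0,1]^d ⊂ ℝ^d`. -/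
def cube (d : ℕ) : Set (Fin d → ℝ) := Set.univ.pi fun _ => Set.Icc (0:ℝ) 1

/-- The unit cube `[0,1]^{d+1} = [0,1]^d × [0,1]`. -/
def cubeP (d : ℕ) : Set ((Fin d → ℝ) × ℝ) := (cube d) ×ˢ Set.Icc (0:ℝ) 1

/-- `√I(α) = Σ_{l=1}^L 2^{dl/4} √(Σ_{j∈I_l} |α_{j,l}|)`; level `l : Fin L` represents level `l+1`. -/
def sqrtNS {L n : ℕ} (d : ℕ) (I : Fin L → Finset (Fin n)) (α : Fin n → ℝ) : ℝ :=
  ∑ l : Fin L, (2:ℝ) ^ (((d * (l.1 + 1) : ℕ) : ℝ) / 4) * Real.sqrt (∑ j ∈ I l, |α j|)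

/-- The nonsparsity measure `I(α)`. -/
def NS {L n : ℕ} (d : ℕ) (I : Fin L → Finset (Fin n)) (α : Fin n → ℝ) : ℝ := (sqrtNS d I α) ^ 2

/-- `f_α = Σ_{l} Σ_{j∈I_l} α_{j,l} ψ_{j,l}`. -/
def fExp {d L n : ℕ} (I : Fin L → Finset (Fin n)) (ψ : Fin n → (Fin d → ℝ) → ℝ)
    (α : Fin n → ℝ) : (Fin d → ℝ) → ℝ :=
  fun s => ∑ l : Fin L, ∑ j ∈ I l, α j * ψ j s

/-- The boundary fragment `G_f = {(s,t) ∈ [0,1]^d × [0,1] : f(s) ≥ t}`. -/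
def fragment {d : ℕ} (f : (Fin d → ℝ) → ℝ) : Set ((Fin d → ℝ) × ℝ) :=
  {p | p.1 ∈ cube d ∧ p.2 ∈ Set.Icc (0:ℝ) 1 ∧ p.2 ≤ f p.1}

/-- Assumption B of the paper: `{ψ_{j,l}}` is an orthonormal wavelet-type system. -/
structure AssumpB (d L n : ℕ) (I : Fin L → Finset (Fin n))
    (ψ : Fin n → (Fin d → ℝ) → ℝ) (cψ : ℝ) : Prop where
  one_le : 1 ≤ cψ
  meas : ∀ k, Measurable (ψ k)
  orthonormal : ∀ j k, (∫ s in cube d, ψ j s * ψ k s) = if j = k then 1 else 0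
  l1_bound : ∀ l : Fin L, ∀ j ∈ I l,
    (∫ s in cube d, |ψ j s|) ≤ cψ * (2:ℝ) ^ (-(((d * (l.1 + 1) : ℕ) : ℝ) / 2))
  sup_bound : ∀ l : Fin L, ∀ s ∈ cube d,
    (∑ j ∈ I l, |ψ j s|) ≤ cψ * (2:ℝ) ^ ((((d * (l.1 + 1) : ℕ) : ℝ)) / 2)
  card_lower : ∀ l : Fin L, (2:ℝ) ^ (d * (l.1 + 1)) / cψ ≤ ((I l).card : ℝ)
  card_upper : ∀ l : Fin L, ((I l).card : ℝ) ≤ cψ * (2:ℝ) ^ (d * (l.1 + 1))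
  levels : (L : ℝ) ≤ cψ * Real.log n / d
  disj : ∀ l l' : Fin L, l ≠ l' → Disjoint (I l) (I l')
  total : ∑ l : Fin L, (I l).card = n

/-- `N_m = Σ_{l=1}^m |I_l|`. -/
def Nm {L n : ℕ} (I : Fin L → Finset (Fin n)) (m : ℕ) : ℕ :=
  ∑ l ∈ Finset.univ.filter (fun l : Fin L => l.1 + 1 ≤ m), (I l).card

/-- `m(α) = min{m : α_{j,l} = 0 for all j ∈ I_l with l > m}`. -/
def mlev {L n : ℕ} (I : Fin L → Finset (Fin n)) (α : Fin n → ℝ) : ℕ :=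
  sInf {m | ∀ l : Fin L, m < l.1 + 1 → ∀ j ∈ I l, α j = 0}

/-- `N(α) = N_{m(α)}`. -/
def Nlev {L n : ℕ} (I : Fin L → Finset (Fin n)) (α : Fin n → ℝ) : ℕ := Nm I (mlev I α)

theorem measurableSet_cube (d : ℕ) : MeasurableSet (cube d) :=
  MeasurableSet.univ_pi fun _ => measurableSet_Icc

theorem volume_cube_lt_top (d : ℕ) : volume (cube d) < ⊤ := by
  have h : IsCompact (cube d) := isCompact_univ_pi fun _ => isCompact_Icc
  exact h.measure_lt_top

theorem integrableOn_cube_of_bounded {d : ℕ} {f : (Fin d → ℝ) → ℝ} (hf : Measurable f) {C : ℝ}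
    (hC : ∀ s ∈ cube d, |f s| ≤ C) : IntegrableOn f (cube d) :=
  IntegrableOn.of_bound (volume_cube_lt_top d) hf.aestronglyMeasurable C
    ((ae_restrict_iff' (measurableSet_cube d)).2 (.of_forall hC))

theorem abs_sign_cast_le_one (x : ℝ) : |(SignType.sign x : ℝ)| ≤ 1 := by
  cases SignType.sign x <;> simp

/-- Key coefficient bound from the proof of Lemma 2: if `{ψ_{j,l}}` is orthonormal in
`L₂([0,1]^d)` and `sup_s Σ_{j∈I_l} |ψ_{j,l}(s)| ≤ c_ψ 2^{dl/2}`, then for every `α` and every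
level `l`, `Σ_{j∈I_l} |α_{j,l}| ≤ c_ψ 2^{dl/2} ‖f_α‖₁`. -/
theorem coeff_bound {d L n : ℕ} (hd : 0 < d) (hL : 0 < L) (hn : 0 < n)
    (I : Fin L → Finset (Fin n)) (ψ : Fin n → (Fin d → ℝ) → ℝ) (cψ : ℝ) (hcψ : 1 ≤ cψ)
    (hmeas : ∀ k, Measurable (ψ k))
    (horth : ∀ j k, (∫ s in cube d, ψ j s * ψ k s) = if j = k then 1 else 0)
    (hsup : ∀ l : Fin L, ∀ s ∈ cube d,
      (∑ j ∈ I l, |ψ j s|) ≤ cψ * (2:ℝ) ^ ((((d * (l.1 + 1) : ℕ) : ℝ)) / 2))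
    (hdisj : ∀ l l' : Fin L, l ≠ l' → Disjoint (I l) (I l'))
    (htotal : ∑ l : Fin L, (I l).card = n)
    (α : Fin n → ℝ) (l : Fin L) :
    (∑ j ∈ I l, |α j|) ≤
      cψ * (2:ℝ) ^ ((((d * (l.1 + 1) : ℕ) : ℝ)) / 2) * (∫ s in cube d, |fExp I ψ α s|) := by
  set C := cψ * (2:ℝ) ^ ((((d * (l.1 + 1) : ℕ) : ℝ)) / 2)
  have hb : ∀ l', ∀ j ∈ I l', ∀ s ∈ cube d,
      |ψ j s| ≤ cψ * (2:ℝ) ^ ((((d * (l'.1 + 1) : ℕ) : ℝ)) / 2) := fun l' j hj s hs =>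
    (single_le_sum (f := fun j => |ψ j s|) (fun _ _ => abs_nonneg _) hj).trans (hsup l' s hs)
  have hprod : ∀ l', ∀ j ∈ I l', ∀ i ∈ I l,
      IntegrableOn (fun s => ψ j s * ψ i s) (cube d) := fun l' j hj i hi =>
    integrableOn_cube_of_bounded ((hmeas j).mul (hmeas i)) fun s hs => by
      rw [abs_mul]
      exact mul_le_mul (hb l' j hj s hs) (hb l i hi s hs) (abs_nonneg _)
        ((abs_nonneg _).trans (hb l' j hj s hs))
  have hf : IntegrableOn (fExp I ψ α) (cube d) :=
    integrable_finsetSum _ fun l' _ => integrable_finsetSum _ fun j hj =>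
      (integrableOn_cube_of_bounded (hmeas j) (hb l' j hj)).const_mul (α j)
  let g : (Fin d → ℝ) → ℝ := fun s => ∑ i ∈ I l, (SignType.sign (α i) : ℝ) * ψ i s
  have hg : ∀ s ∈ cube d, |g s| ≤ C := fun s hs =>
    calc |g s| ≤ ∑ i ∈ I l, |(SignType.sign (α i) : ℝ) * ψ i s| := abs_sum_le_sum_abs _ _
      _ ≤ ∑ i ∈ I l, |ψ i s| := sum_le_sum fun i _ => by
        rw [abs_mul]
        exact mul_le_of_le_one_left (abs_nonneg _) (abs_sign_cast_le_one _)
      _ ≤ C := hsup l s hs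
  have hexp : (fun s => fExp I ψ α s * g s) = fun s => ∑ i ∈ I l, ∑ l' : Fin L, ∑ j ∈ I l',
      (α j * (SignType.sign (α i) : ℝ)) * (ψ j s * ψ i s) := by
    funext s
    simp only [fExp, g, mul_sum, sum_mul]
    refine sum_congr rfl fun i _ => sum_congr rfl fun l' _ => sum_congr rfl fun j _ => by ring
  have hterm : ∀ i ∈ I l, ∀ l' : Fin L, ∀ j ∈ I l', IntegrableOn
      (fun s => (α j * (SignType.sign (α i) : ℝ)) * (ψ j s * ψ i s)) (cube d) :=
    fun i hi l' j hj => (hprod l' j hj i hi).const_mul _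
  have hpair : (∫ s in cube d, fExp I ψ α s * g s) = ∑ i ∈ I l, |α i| := by
    rw [hexp, integral_finsetSum _ fun i hi => integrable_finsetSum _ fun l' _ =>
      integrable_finsetSum _ fun j hj => hterm i hi l' j hj]
    refine sum_congr rfl fun i hi => ?_
    rw [integral_finsetSum _ fun l' _ => integrable_finsetSum _ fun j hj => hterm i hi l' j hj,
      sum_eq_single l]
    · rw [integral_finsetSum _ fun j hj => hterm i hi l j hj]
      simp [integral_const_mul, horth, hi, self_mul_sign]
    · intro l' _ hl'
      rw [integral_finsetSum _ fun j hj => hterm i hi l' j hj]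
      have hi' : i ∉ I l' := fun h => disjoint_left.1 (hdisj l' l hl') h hi
      simp [integral_const_mul, horth, hi']
    · simp
  have hfg : IntegrableOn (fun s => fExp I ψ α s * g s) (cube d) := by
    rw [hexp]
    exact integrable_finsetSum _ fun i hi => integrable_finsetSum _ fun l' _ =>
      integrable_finsetSum _ fun j hj => hterm i hi l' j hj
  rw [← hpair, ← integral_const_mul]
  refine setIntegral_mono_on hfg (hf.abs.const_mul C) (measurableSet_cube d) fun s hs => ?_
  calc fExp I ψ α s * g s ≤ |fExp I ψ α s| * |g s| := (le_abs_self _).trans (abs_mul _ _).le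
    _ ≤ |fExp I ψ α s| * C := mul_le_mul_of_nonneg_left (hg s hs) (abs_nonneg _)
    _ = C * |fExp I ψ α s| := mul_comm _ _
end
end

section
/- Under Assumption B, for every M with 0 < M ≤ n and every δ > 0, there exists a finite set S of real-valued functions on [0,1]^d with cardinality |S| ≤ (n+1)^{M/δ} · (2M/δ + 1)^{M/δ} such that for every α ∈ ℝⁿ with I(α) ≤ M there is g ∈ S with sup_{s∈[0,1]^d} |f_α(s) − g(s)| ≤ (c_ψ² (log n)/d) · δ. Consequently the δ·(c_ψ²(log n)/d)-entropy of {f_α : I(α) ≤ M} for the sup-norm is at most (M/δ)(log(2M/δ + 1) + log(n+1)). (Sup-norm entropy bound (7.6) in the proof of Lemma 3.) -/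
open MeasureTheory Finset
open scoped symmDiff

noncomputable section

open scoped Pointwise

lemma exists_int_abs_le_abs_sub_le_one (x : ℝ) : ∃ z : ℤ, |(z : ℝ)| ≤ |x| ∧ |x - z| ≤ 1 := by
  rcases le_total 0 x with hx | hx
  · have h0 : (0 : ℝ) ≤ ⌊x⌋ := by exact_mod_cast Int.floor_nonneg.2 hx
    have h1 := Int.floor_le x
    have h2 := Int.lt_floor_add_one x
    refine ⟨⌊x⌋, ?_, ?_⟩
    · rwa [abs_of_nonneg h0, abs_of_nonneg hx]
    · rw [abs_le]; constructor <;> linarith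
  · have h0 : (⌈x⌉ : ℝ) ≤ 0 := by exact_mod_cast Int.ceil_le.2 (by simpa using hx)
    have h1 := Int.le_ceil x
    have h2 := Int.ceil_lt_add_one x
    refine ⟨⌈x⌉, ?_, ?_⟩
    · rw [abs_of_nonpos h0, abs_of_nonpos hx]; linarith
    · rw [abs_le]; constructor <;> linarith

/-- The vectors `0` and `±e_j` of the integer lattice. -/
def latticeSteps (n : ℕ) : Finset (Fin n → ℤ) :=
  insert 0 (univ.image (fun j => Pi.single j 1) ∪ univ.image (fun j => Pi.single j (-1)))

lemma card_latticeSteps_le (n : ℕ) : (latticeSteps n).card ≤ 2 * n + 1 := by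
  have h1 := card_image_le (s := (univ : Finset (Fin n)))
    (f := fun j => (Pi.single j 1 : Fin n → ℤ))
  have h2 := card_image_le (s := (univ : Finset (Fin n)))
    (f := fun j => (Pi.single j (-1) : Fin n → ℤ))
  rw [card_univ, Fintype.card_fin] at h1 h2
  refine (card_insert_le _ _).trans ?_
  have h3 := card_union_le (univ.image (fun j => (Pi.single j 1 : Fin n → ℤ)))
    (univ.image (fun j => (Pi.single j (-1) : Fin n → ℤ)))
  omega

lemma mem_nsmul_latticeSteps {n : ℕ} (K : ℕ) (k : Fin n → ℤ) (hk : ∑ j, |k j| ≤ K) :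
    k ∈ K • latticeSteps n := by
  induction K generalizing k with
  | zero =>
    have h0 : ∑ j, |k j| = 0 := le_antisymm (by simpa using hk) (sum_nonneg fun j _ => abs_nonneg _)
    rw [sum_eq_zero_iff_of_nonneg fun j _ => abs_nonneg _] at h0
    have : k = 0 := funext fun j => abs_eq_zero.1 (h0 j (mem_univ j))
    simp [this]
  | succ K ih =>
    rw [succ_nsmul, mem_add]
    by_cases h : ∃ j, k j ≠ 0
    · obtain ⟨j, hj⟩ := h
      obtain ⟨ε, hε, hlt⟩ : ∃ ε : ℤ, (ε = 1 ∨ ε = -1) ∧ |k j - ε| = |k j| - 1 := by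
        rcases lt_or_gt_of_ne hj with h | h
        · exact ⟨-1, Or.inr rfl, by rw [abs_of_neg h, abs_of_nonpos (by omega)]; omega⟩
        · exact ⟨1, Or.inl rfl, by rw [abs_of_pos h, abs_of_nonneg (by omega)]⟩
      refine ⟨k - Pi.single j ε, ih _ ?_, Pi.single j ε, ?_, by simp⟩
      · have h1 : ∀ i, |(k - Pi.single j ε : Fin n → ℤ) i| = |k i| - if i = j then 1 else 0 := by
          intro i
          by_cases hi : i = j
          · subst hi; simpa using hlt
          · simp [hi]
        simp_rw [h1, sum_sub_distrib]
        simp only [sum_ite_eq', mem_univ, if_true]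
        push_cast at hk
        linarith
      · rcases hε with rfl | rfl <;> simp [latticeSteps]
    · push Not at h
      have : k = 0 := funext h
      subst this
      exact ⟨0, ih 0 (by simp), 0, by simp [latticeSteps], by simp⟩

lemma sum_scaled_abs_le_NS {L n : ℕ} (d : ℕ) (I : Fin L → Finset (Fin n)) (α : Fin n → ℝ) :
    ∑ l : Fin L, ∑ j ∈ I l, (2 : ℝ) ^ (((d * (l.1 + 1) : ℕ) : ℝ) / 2) * |α j| ≤ NS d I α := by
  have h : ∀ l : Fin L, ∑ j ∈ I l, (2 : ℝ) ^ (((d * (l.1 + 1) : ℕ) : ℝ) / 2) * |α j| =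
      ((2 : ℝ) ^ (((d * (l.1 + 1) : ℕ) : ℝ) / 4) * Real.sqrt (∑ j ∈ I l, |α j|)) ^ 2 := by
    intro l
    rw [mul_pow, Real.sq_sqrt (sum_nonneg fun j _ => abs_nonneg _), ← mul_sum,
      ← Real.rpow_natCast, ← Real.rpow_mul (by norm_num)]
    congr 2
    push_cast
    ring
  simp_rw [h]
  exact sum_sq_le_sq_sum_of_nonneg fun l _ => by positivity

lemma two_mul_add_one_pow_floor_le (n : ℕ) {x : ℝ} (hx : 0 ≤ x) :
    ((2 * n + 1 : ℕ) : ℝ) ^ ⌊x⌋₊ ≤ ((n : ℝ) + 1) ^ x * (2 * x + 1) ^ x := by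
  have hn : (0 : ℝ) ≤ n := n.cast_nonneg
  rw [← Real.mul_rpow (by positivity) (by positivity)]
  have hbase : 1 ≤ ((n : ℝ) + 1) * (2 * x + 1) := by nlinarith [mul_nonneg hn hx]
  rcases lt_or_ge x 1 with h1 | h1
  · rw [Nat.floor_eq_zero.2 h1, pow_zero]
    exact Real.one_le_rpow hbase hx
  · calc ((2 * n + 1 : ℕ) : ℝ) ^ ⌊x⌋₊ ≤ (((n : ℝ) + 1) * (2 * x + 1)) ^ ⌊x⌋₊ := by
          gcongr
          push_cast
          nlinarith
      _ = (((n : ℝ) + 1) * (2 * x + 1)) ^ (⌊x⌋₊ : ℝ) := (Real.rpow_natCast _ _).symm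
      _ ≤ _ := Real.rpow_le_rpow_of_exponent_le hbase (Nat.floor_le hx)

/-- Sup-norm entropy bound (7.6) in the proof of Lemma 3: under Assumption B, for `0 < M ≤ n`
and `δ > 0` there is a `(c_ψ² (log n)/d)·δ`-net, for the sup-norm on `[0,1]^d`, of the class
`{f_α : I(α) ≤ M}` of cardinality at most `(n+1)^{M/δ} (2M/δ + 1)^{M/δ}`; consequently the
corresponding sup-norm entropy is at most `(M/δ)(log(2M/δ + 1) + log(n+1))`. -/
theorem supnorm_entropy_bound {d L n : ℕ} (hd : 0 < d) (hL : 0 < L) (hn : 0 < n)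
    (I : Fin L → Finset (Fin n)) (ψ : Fin n → (Fin d → ℝ) → ℝ) (cψ : ℝ)
    (hB : AssumpB d L n I ψ cψ) (M δ : ℝ) (hM0 : 0 < M) (hMn : M ≤ n) (hδ : 0 < δ) :
    ∃ S : Finset ((Fin d → ℝ) → ℝ),
      ((S.card : ℝ) ≤ ((n : ℝ) + 1) ^ (M / δ) * (2 * M / δ + 1) ^ (M / δ)) ∧
      Real.log S.card ≤ (M / δ) * (Real.log (2 * M / δ + 1) + Real.log ((n : ℝ) + 1)) ∧
      ∀ α : Fin n → ℝ, NS d I α ≤ M → ∃ g ∈ S, ∀ s ∈ cube d,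
        |fExp I ψ α s - g s| ≤ (cψ ^ 2 * Real.log n / d) * δ := by
  set w : Fin L → ℝ := fun l => (2 : ℝ) ^ (((d * (l.1 + 1) : ℕ) : ℝ) / 2)
  have hwpos : ∀ l, 0 < w l := fun l => by positivity
  have hx : 0 ≤ M / δ := by positivity
  let G : (Fin n → ℤ) → (Fin d → ℝ) → ℝ := fun k s =>
    ∑ l : Fin L, ∑ j ∈ I l, δ / w l * k j * ψ j s
  classical
  set S := (⌊M / δ⌋₊ • latticeSteps n).image G
  have hcard : (S.card : ℝ) ≤ ((n : ℝ) + 1) ^ (M / δ) * (2 * M / δ + 1) ^ (M / δ) := by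
    rw [mul_div_assoc]
    refine le_trans ?_ (two_mul_add_one_pow_floor_le n hx)
    exact_mod_cast (card_image_le.trans card_nsmul_le).trans
      (Nat.pow_le_pow_left (card_latticeSteps_le n) _)
  have hone : (1 : ℝ) ≤ 2 * M / δ + 1 := by rw [mul_div_assoc]; linarith
  refine ⟨S, hcard, ?_, fun α hα => ?_⟩
  · rcases S.card.eq_zero_or_pos with h0 | hpos
    · rw [h0, Nat.cast_zero, Real.log_zero]
      have h1 := Real.log_nonneg hone
      have h2 := Real.log_natCast_nonneg (n + 1)
      push_cast at h2
      positivity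
    · refine (Real.log_le_log (by exact_mod_cast hpos) hcard).trans_eq ?_
      rw [Real.log_mul (by positivity) (by positivity), Real.log_rpow (by positivity),
        Real.log_rpow (by positivity)]
      ring
  choose z hz1 hz2 using exists_int_abs_le_abs_sub_le_one
  let k : Fin n → ℤ := fun j => ∑ l, if j ∈ I l then z (w l * α j / δ) else 0
  have hk : ∀ l, ∀ j ∈ I l, k j = z (w l * α j / δ) := by
    intro l j hj
    have hl : ∀ l' ≠ l, (if j ∈ I l' then z (w l' * α j / δ) else 0) = 0 := fun l' hl' =>
      if_neg fun hj' => disjoint_left.1 (hB.disj l' l hl') hj' hj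
    exact (Fintype.sum_eq_single l hl).trans (if_pos hj)
  have hksum : ∑ j, |k j| ≤ (⌊M / δ⌋₊ : ℤ) := by
    rw [Int.natCast_floor_eq_floor hx, Int.le_floor]
    push_cast
    calc ∑ j, |(k j : ℝ)| ≤ ∑ j, ∑ l, if j ∈ I l then w l * |α j| / δ else 0 := by
          refine sum_le_sum fun j _ => ?_
          simp only [k, Int.cast_sum]
          refine (abs_sum_le_sum_abs _ _).trans (sum_le_sum fun l _ => ?_)
          split_ifs
          · refine (hz1 _).trans_eq ?_
            rw [abs_div, abs_mul, abs_of_pos (hwpos l), abs_of_pos hδ]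
          · simp
      _ = (∑ l, ∑ j ∈ I l, w l * |α j|) / δ := by
          rw [sum_comm, sum_div]
          refine sum_congr rfl fun l _ => ?_
          rw [sum_div, sum_ite_mem, univ_inter]
      _ ≤ M / δ := by
          gcongr
          exact (sum_scaled_abs_le_NS d I α).trans hα
  refine ⟨G k, mem_image_of_mem G (mem_nsmul_latticeSteps _ k hksum), fun s hs => ?_⟩
  calc |fExp I ψ α s - G k s|
      = |∑ l, ∑ j ∈ I l, (α j - δ / w l * k j) * ψ j s| := by
        simp only [fExp, G, ← sum_sub_distrib, sub_mul]
    _ ≤ ∑ l, ∑ j ∈ I l, |(α j - δ / w l * k j) * ψ j s| :=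
        (abs_sum_le_sum_abs _ _).trans (sum_le_sum fun l _ => abs_sum_le_sum_abs _ _)
    _ ≤ ∑ l : Fin L, cψ * δ := by
        refine sum_le_sum fun l _ => ?_
        calc ∑ j ∈ I l, |(α j - δ / w l * k j) * ψ j s|
            ≤ ∑ j ∈ I l, δ / w l * |ψ j s| := by
              refine sum_le_sum fun j hj => ?_
              rw [abs_mul]
              gcongr
              have hfac : α j - δ / w l * k j = δ / w l * (w l * α j / δ - k j) := by
                have := (hwpos l).ne'
                field_simp
              have hpos : 0 < δ / w l := div_pos hδ (hwpos l)
              rw [hfac, abs_mul, abs_of_pos hpos, hk l j hj]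
              exact mul_le_of_le_one_right hpos.le (hz2 _)
          _ ≤ δ / w l * (cψ * w l) := by
              rw [← mul_sum]
              exact mul_le_mul_of_nonneg_left (hB.sup_bound l s hs) (div_pos hδ (hwpos l)).le
          _ = cψ * δ := by
              have := (hwpos l).ne'
              field_simp
    _ = L * (cψ * δ) := by simp
    _ ≤ cψ * Real.log n / d * (cψ * δ) := by
        have := hB.one_le
        exact mul_le_mul_of_nonneg_right hB.levels (by positivity)
    _ = (cψ ^ 2 * Real.log n / d) * δ := by ring
end
end

section
/- Let α*, α ∈ ℝⁿ and let m* be an integer such that α*_{j,l} = 0 for all j ∈ I_l whenever l > m*. Then √I(α − α*) − √I(α) + √I(α*) ≤ 2·√(I^{(1)}(α − α*)), where √(I^{(1)}(β)) = Σ_{l=1}^{m*} 2^{dl/4} √(Σ_{j∈I_l} |β_{j,l}|). (Key cancellation property of the square root penalty used in the proof of Theorem 1.) -/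
open MeasureTheory Finset
open scoped symmDiff

noncomputable section

/-- `√I^{(1)}(α) = Σ_{l=1}^{m*} 2^{dl/4} √(Σ_{j∈I_l} |α_{j,l}|)`, the truncated nonsparsity. -/
def sqrtNS1 {L n : ℕ} (d : ℕ) (I : Fin L → Finset (Fin n)) (m : ℕ) (α : Fin n → ℝ) : ℝ :=
  ∑ l ∈ Finset.univ.filter (fun l : Fin L => l.1 + 1 ≤ m),
    (2:ℝ) ^ (((d * (l.1 + 1) : ℕ) : ℝ) / 4) * Real.sqrt (∑ j ∈ I l, |α j|)

/-- Subadditivity of the square root of the `ℓ¹` norm: `√‖b‖₁ ≤ √‖a‖₁ + √‖a - b‖₁`. -/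
theorem sqrt_sum_abs_le_add_sub {ι : Type*} (s : Finset ι) (a b : ι → ℝ) :
    Real.sqrt (∑ j ∈ s, |b j|) ≤ Real.sqrt (∑ j ∈ s, |a j|) + Real.sqrt (∑ j ∈ s, |(a - b) j|) := by
  simp only [Real.sqrt_eq_rpow]
  refine (Real.rpow_le_rpow (by positivity) ?_ (by norm_num)).trans
    (Real.rpow_add_le_add_rpow (by positivity) (by positivity) (by norm_num) (by norm_num))
  rw [← Finset.sum_add_distrib]
  refine Finset.sum_le_sum fun j _ => ?_
  have h := abs_sub (a j) (a j - b j)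
  rwa [sub_sub_cancel] at h

/-- Key cancellation property of the square root penalty (proof of Theorem 1): if `α*`
vanishes above level `m*`, then `√I(α − α*) − √I(α) + √I(α*) ≤ 2 √I^{(1)}(α − α*)`. -/
theorem sqrt_penalty_cancellation {d L n : ℕ} (hd : 0 < d) (hL : 0 < L) (hn : 0 < n)
    (I : Fin L → Finset (Fin n)) (αstar α : Fin n → ℝ) (mstar : ℕ) (hm : mstar ≤ L)
    (hstar : ∀ l : Fin L, mstar < l.1 + 1 → ∀ j ∈ I l, αstar j = 0) :
    sqrtNS d I (α - αstar) - sqrtNS d I α + sqrtNS d I αstar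
      ≤ 2 * sqrtNS1 d I mstar (α - αstar) := by
  unfold sqrtNS sqrtNS1
  rw [← Finset.sum_sub_distrib, ← Finset.sum_add_distrib, Finset.mul_sum, Finset.sum_filter]
  refine Finset.sum_le_sum fun l _ => ?_
  have hw : (0 : ℝ) ≤ (2 : ℝ) ^ (((d * (l.1 + 1) : ℕ) : ℝ) / 4) := by positivity
  split_ifs with h
  · have key := mul_le_mul_of_nonneg_left (sqrt_sum_abs_le_add_sub (I l) α αstar) hw
    linarith
  · have hz := hstar l (not_le.mp h)
    have hdiff : ∑ j ∈ I l, |(α - αstar) j| = ∑ j ∈ I l, |α j| :=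
      Finset.sum_congr rfl fun j hj => by simp [hz j hj]
    have hzero : ∑ j ∈ I l, |αstar j| = 0 :=
      Finset.sum_eq_zero fun j hj => by simp [hz j hj]
    rw [hdiff, hzero]
    simp
end
end

section
/- Let r, r_n : ℝⁿ → ℝ be arbitrary functions, let λ ≥ 0 and ε ≥ 0, let α* ∈ ℝⁿ and let m* be an integer such that α*_{j,l} = 0 for all j ∈ I_l with l > m*. Suppose α̂ ∈ ℝⁿ satisfies r_n(α̂) + λ√I(α̂) ≤ r_n(α*) + λ√I(α*) and suppose |(r_n(α̂) − r(α̂)) − (r_n(α*) − r(α*))| ≤ λ√I(α̂ − α*) + λε. Then r(α̂) ≤ r(α*) + 2λ√(I^{(1)}(α̂ − α*)) + λε. (The deterministic 'basic inequality' (7.14) underlying the proof of Theorem 1.) -/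
open MeasureTheory Finset
open scoped symmDiff

noncomputable section

theorem Real.sqrt_sum_abs_le_sqrt_sum_abs_add_sub {ι : Type*} (s : Finset ι) (x y : ι → ℝ) :
    √(∑ j ∈ s, |y j|) ≤ √(∑ j ∈ s, |x j|) + √(∑ j ∈ s, |(x - y) j|) := by
  have hx : 0 ≤ ∑ j ∈ s, |x j| := Finset.sum_nonneg fun _ _ => abs_nonneg _
  have hxy : 0 ≤ ∑ j ∈ s, |(x - y) j| := Finset.sum_nonneg fun _ _ => abs_nonneg _
  have h : ∑ j ∈ s, |y j| ≤ ∑ j ∈ s, |x j| + ∑ j ∈ s, |(x - y) j| := by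
    rw [← Finset.sum_add_distrib]
    refine Finset.sum_le_sum fun j _ => ?_
    simpa using abs_sub (x j) (x j - y j)
  refine Real.sqrt_le_iff.mpr ⟨by positivity, ?_⟩
  nlinarith [Real.sq_sqrt hx, Real.sq_sqrt hxy,
    mul_nonneg (Real.sqrt_nonneg (∑ j ∈ s, |x j|)) (Real.sqrt_nonneg (∑ j ∈ s, |(x - y) j|))]

/-- If `β` vanishes above level `m`, then `√I(β) + √I(α - β) ≤ √I(α) + 2 √I^{(1)}(α - β)`. -/
theorem sqrtNS_add_sqrtNS_sub_le {L n : ℕ} (d : ℕ) (I : Fin L → Finset (Fin n)) (m : ℕ)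
    (α β : Fin n → ℝ) (hβ : ∀ l : Fin L, m < l.1 + 1 → ∀ j ∈ I l, β j = 0) :
    sqrtNS d I β + sqrtNS d I (α - β) ≤ sqrtNS d I α + 2 * sqrtNS1 d I m (α - β) := by
  unfold sqrtNS sqrtNS1
  rw [Finset.sum_filter, Finset.mul_sum, ← Finset.sum_add_distrib, ← Finset.sum_add_distrib]
  refine Finset.sum_le_sum fun l _ => ?_
  split_ifs with hl
  · have h := mul_le_mul_of_nonneg_left
      (Real.sqrt_sum_abs_le_sqrt_sum_abs_add_sub (I l) α β)
      (by positivity : (0:ℝ) ≤ (2:ℝ) ^ (((d * (l.1 + 1) : ℕ) : ℝ) / 4))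
    linarith
  · have hz := hβ l (not_le.mp hl)
    have h₀ : ∑ j ∈ I l, |β j| = 0 := Finset.sum_eq_zero fun j hj => by simp [hz j hj]
    have h₁ : ∑ j ∈ I l, |(α - β) j| = ∑ j ∈ I l, |α j| :=
      Finset.sum_congr rfl fun j hj => by simp [hz j hj]
    rw [h₀, h₁]; simp

/-- The deterministic "basic inequality" (7.14) underlying the proof of Theorem 1. -/
theorem basic_inequality {d L n : ℕ} (hd : 0 < d) (hL : 0 < L) (hn : 0 < n)
    (I : Fin L → Finset (Fin n)) (r rn : (Fin n → ℝ) → ℝ) (lam ε : ℝ)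
    (hlam : 0 ≤ lam) (hε : 0 ≤ ε)
    (αstar : Fin n → ℝ) (mstar : ℕ) (hm : mstar ≤ L)
    (hstar : ∀ l : Fin L, mstar < l.1 + 1 → ∀ j ∈ I l, αstar j = 0)
    (αhat : Fin n → ℝ)
    (hmin : rn αhat + lam * sqrtNS d I αhat ≤ rn αstar + lam * sqrtNS d I αstar)
    (hdev : |(rn αhat - r αhat) - (rn αstar - r αstar)|
      ≤ lam * sqrtNS d I (αhat - αstar) + lam * ε) :
    r αhat ≤ r αstar + 2 * lam * sqrtNS1 d I mstar (αhat - αstar) + lam * ε := by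
  have h := mul_le_mul_of_nonneg_left
    (sqrtNS_add_sqrtNS_sub_le d I mstar αhat αstar hstar) hlam
  have hdev' := (abs_le.mp hdev).1
  linarith
end
end
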